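/- (Uniform weighted sup bound for families of solutions.) Let n ≥ 3 be an integer, let Ω ⊂ ℝⁿ be a smooth bounded domain with 0 ∈ Ω, let 0 < s < 2, γ < (n−2)²/4, and write 2⋆(s) = 2(n−s)/(n−2). Let h ∈ C¹(Ω̄\{0}) satisfy, for some 0 ≤ θ < 2 and c ∈ ℝ, lim_{x→0}|x|^θ h(x) = c and lim_{x→0}|x|^θ⟨x,∇h(x)⟩ = −cθ, with −Δ − γ/|x|² − h coercive on Ω; let b ∈ C¹(Ω̄) be nonnegative with b(0) > 0 and ∇b(0) = 0. Let p_ε ∈ [0, 2⋆(s)−2) with p_ε → 0 as ε → 0, and for each ε > 0 let u_ε be a classical solution of −Δu_ε − γu_ε/|x|² − h u_ε = b(x)|u_ε|^{2⋆(s)−2−p_ε}u_ε/|x|^s in Ω with u_ε = 0 on ∂Ω, such that sup_ε ∫_Ω |∇u_ε|² dx < ∞. Then there exists C > 0 such that |x|^{(n−2)/2} |u_ε(x)|^{1 − p_ε/(2⋆(s)−2)} ≤ C for all sufficiently small ε > 0 and all x ∈ Ω\{0}. -/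

import Mathlib

open Real Filter Set MeasureTheory

/-- The Euclidean Laplacian of `u : ℝⁿ → ℝ` at `x`, as the trace of the second derivative. -/
noncomputable def lap (n : ℕ) (u : EuclideanSpace ℝ (Fin n) → ℝ)
    (x : EuclideanSpace ℝ (Fin n)) : ℝ :=
  ∑ i : Fin n,
    fderiv ℝ (fun y => fderiv ℝ u y (EuclideanSpace.single i 1)) x (EuclideanSpace.single i 1)

/-- A smooth bounded domain in `ℝⁿ`. -/
def SmoothDomain {n : ℕ} (Ω : Set (EuclideanSpace ℝ (Fin n))) : Prop :=
  IsOpen Ω ∧ Bornology.IsBounded Ω ∧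
    ∀ x ∈ frontier Ω, ∃ (U : Set (EuclideanSpace ℝ (Fin n)))
      (φ : EuclideanSpace ℝ (Fin n) → ℝ), IsOpen U ∧ x ∈ U ∧ ContDiff ℝ (⊤ : ℕ∞) φ ∧
        (∀ y ∈ U, fderiv ℝ φ y ≠ 0) ∧ Ω ∩ U = {y ∈ U | φ y < 0}

/-- Coercivity of the operator `−Δ − γ/|x|² − h` on `Ω`. -/
def CoerciveOn {n : ℕ} (Ω : Set (EuclideanSpace ℝ (Fin n))) (γ : ℝ)
    (h : EuclideanSpace ℝ (Fin n) → ℝ) : Prop :=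
  ∃ Λ > (0 : ℝ), ∀ φ : EuclideanSpace ℝ (Fin n) → ℝ,
    ContDiff ℝ (⊤ : ℕ∞) φ → HasCompactSupport φ → tsupport φ ⊆ Ω →
      Λ * ∫ x in Ω, ‖fderiv ℝ φ x‖ ^ 2 ≤
        (∫ x in Ω, ‖fderiv ℝ φ x‖ ^ 2) - γ * (∫ x in Ω, φ x ^ 2 / ‖x‖ ^ 2)
          - ∫ x in Ω, h x * φ x ^ 2

/-- A classical solution `u ∈ C⁰(Ω̄) ∩ C²(Ω̄\{0})` with finite energy, vanishing on `∂Ω`, of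
`−Δu − γu/|x|² − hu = b(x)|u|^{q−2}u/|x|^s` on `Ω\{0}`. -/
def ClassicalSolution {n : ℕ} (Ω : Set (EuclideanSpace ℝ (Fin n))) (γ : ℝ)
    (h b : EuclideanSpace ℝ (Fin n) → ℝ) (q s : ℝ)
    (u : EuclideanSpace ℝ (Fin n) → ℝ) : Prop :=
  ContinuousOn u (closure Ω) ∧ ContDiffOn ℝ 2 u (closure Ω \ {0}) ∧
  IntegrableOn (fun x => ‖fderiv ℝ u x‖ ^ 2) Ω ∧
  (∀ x ∈ frontier Ω, u x = 0) ∧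
  ∀ x ∈ Ω \ {0},
    -lap n u x - γ * u x / ‖x‖ ^ 2 - h x * u x = b x * |u x| ^ (q - 2) * u x / ‖x‖ ^ s

/-- The integral of the divergence of a compactly supported continuous vector field, differentiable
outside a countable set, vanishes. -/
theorem integral_divergence_eq_zero_of_hasCompactSupport {n : ℕ} (hn : n ≠ 0)
    (f : Fin n → EuclideanSpace ℝ (Fin n) → ℝ)
    (f' : Fin n → EuclideanSpace ℝ (Fin n) → EuclideanSpace ℝ (Fin n) →L[ℝ] ℝ)
    (t : Set (EuclideanSpace ℝ (Fin n))) (ht : t.Countable)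
    (hc : ∀ i, Continuous (f i)) (hs : ∀ i, HasCompactSupport (f i))
    (hd : ∀ x ∉ t, ∀ i, HasFDerivAt (f i) (f' i x) x)
    (hi : Integrable (fun x => ∑ i, f' i x (EuclideanSpace.single i 1))) :
    ∫ x, ∑ i, f' i x (EuclideanSpace.single i 1) = 0 := by
  obtain ⟨m, rfl⟩ := Nat.exists_eq_succ_of_ne_zero hn
  obtain ⟨R, hR0, hR⟩ : ∃ R > 0, ∀ i, tsupport (f i) ⊆ Metric.ball 0 R := by
    have hK : IsCompact (⋃ i, tsupport (f i)) := isCompact_iUnion fun i => hs i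
    obtain ⟨R, hR0, hR⟩ := hK.isBounded.subset_ball_lt 0 0
    exact ⟨R, hR0, fun i => (subset_iUnion _ i).trans hR⟩
  let L : (Fin (m + 1) → ℝ) ≃L[ℝ] EuclideanSpace ℝ (Fin (m + 1)) :=
    (EuclideanSpace.equiv (Fin (m + 1)) ℝ).symm
  have hL : ∀ x, L x = WithLp.toLp 2 x := fun x => rfl
  have hmp : MeasurePreserving L volume volume := PiLp.volume_preserving_toLp (Fin (m + 1))
  have hemb : MeasurableEmbedding L := L.toHomeomorph.measurableEmbedding
  have hLs : ∀ i, L (Pi.single i 1) = EuclideanSpace.single i 1 := fun i => rfl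
  have hcoord : ∀ (x : Fin (m + 1) → ℝ) i, R ≤ |x i| → ∀ j, L x ∉ tsupport (f j) := by
    intro x i hxi j hmem
    have h1 := hR j hmem
    rw [mem_ball_zero_iff] at h1
    have h2 := PiLp.norm_apply_le (L x) i
    rw [Real.norm_eq_abs] at h2
    exact absurd (hxi.trans h2) (not_le.2 h1)
  set G : (Fin (m + 1) → ℝ) → ℝ := fun x => ∑ i, f' i (L x) (EuclideanSpace.single i 1) with hG
  have hGi : Integrable G := (hmp.integrable_comp_emb hemb).2 hi
  have key := integral_divergence_of_hasFDerivAt_off_countable' (fun _ => -R) (fun _ => R)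
    (fun _ => by linarith) (fun i x => f i (L x))
    (fun i x => (f' i (L x)).comp (L : (Fin (m + 1) → ℝ) →L[ℝ] _)) (L ⁻¹' t)
    (ht.preimage L.injective)
    (fun i => ((hc i).comp L.continuous).continuousOn)
    (fun x hx i => (hd (L x) hx.2 i).comp x L.hasFDerivAt)
    hGi.integrableOn
  have hzero : ∀ (x : Fin (m + 1) → ℝ) i, R ≤ |x i| → ∀ j, f j (L x) = 0 :=
    fun x i hxi j => image_eq_zero_of_notMem_tsupport (hcoord x i hxi j)
  have hrhs : ∀ i : Fin (m + 1), ∀ c : ℝ, R ≤ |c| → ∀ x, f i (L (i.insertNth c x)) = 0 :=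
    fun i c hc x => hzero _ i (by simpa using hc) i
  have hRR : R ≤ |R| := le_abs_self R
  have hRR' : R ≤ |-R| := by rw [abs_neg]; exact hRR
  simp only [hrhs _ _ hRR, hrhs _ _ hRR', integral_zero, sub_zero, Finset.sum_const_zero] at key
  rw [← hmp.integral_comp hemb]
  refine Eq.trans ?_ key
  refine (setIntegral_eq_integral_of_ae_compl_eq_zero ?_).symm
  have hae : ∀ᵐ x : Fin (m + 1) → ℝ, x ∉ L ⁻¹' t :=
    (ht.preimage L.injective).ae_notMem volume
  filter_upwards [hae] with x hx hxI
  have : ∃ i, R ≤ |x i| := by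
    by_contra! hcon
    exact hxI ⟨fun i => (abs_lt.1 (hcon i)).1.le, fun i => (abs_lt.1 (hcon i)).2.le⟩
  obtain ⟨i, hxi⟩ := this
  refine Finset.sum_eq_zero fun j _ => ?_
  have h1 : f j =ᶠ[nhds (L x)] fun _ => 0 :=
    notMem_tsupport_iff_eventuallyEq.1 (hcoord x i hxi j)
  have h2 : f' j (L x) = 0 :=
    (hd (L x) hx j).unique ((hasFDerivAt_const (0 : ℝ) (L x)).congr_of_eventuallyEq h1)
  simp [h2]

theorem EuclideanSpace.sum_apply_single_mul {n : ℕ}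
    (l : EuclideanSpace ℝ (Fin n) →L[ℝ] ℝ) (y : EuclideanSpace ℝ (Fin n)) :
    ∑ i, l (EuclideanSpace.single i 1) * y i = l y := by
  have h := congrArg l ((EuclideanSpace.basisFun (Fin n) ℝ).sum_repr y)
  rw [map_sum] at h
  rw [← h]
  refine Finset.sum_congr rfl fun i _ => ?_
  simp [mul_comm]

/-- The vector field `(x - x₀) / (‖x - x₀‖² + r²)` in coordinates. -/
theorem hasFDerivAt_regularized_radial {n : ℕ} (x₀ x : EuclideanSpace ℝ (Fin n)) {r : ℝ}
    (hr : 0 < r) (i : Fin n) :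
    ∃ l : EuclideanSpace ℝ (Fin n) →L[ℝ] ℝ,
      HasFDerivAt (fun z : EuclideanSpace ℝ (Fin n) => (z i - x₀ i) / (‖z - x₀‖ ^ 2 + r ^ 2)) l x ∧
      l (EuclideanSpace.single i 1) =
        1 / (‖x - x₀‖ ^ 2 + r ^ 2) - 2 * (x i - x₀ i) ^ 2 / (‖x - x₀‖ ^ 2 + r ^ 2) ^ 2 := by
  have hpos : 0 < ‖x - x₀‖ ^ 2 + r ^ 2 := by positivity
  have h1 : HasFDerivAt (fun z : EuclideanSpace ℝ (Fin n) => z i - x₀ i)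
      (EuclideanSpace.proj i : EuclideanSpace ℝ (Fin n) →L[ℝ] ℝ) x :=
    ((EuclideanSpace.proj i : EuclideanSpace ℝ (Fin n) →L[ℝ] ℝ).hasFDerivAt).sub_const _
  have h2 := (((hasFDerivAt_id x).sub_const x₀).norm_sq).add_const (r ^ 2)
  have h3 := h1.mul ((hasDerivAt_inv hpos.ne').comp_hasFDerivAt x h2)
  refine ⟨_, h3.congr_of_eventuallyEq (Eventually.of_forall fun z => div_eq_mul_inv _ _), ?_⟩
  simp [EuclideanSpace.inner_single_right]
  field_simp
  try ring

theorem one_div_le_radial_divergence {n a c : ℝ} (hn : 3 ≤ n) (hc : 0 ≤ c)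
    (hac : 0 < a + c) : 1 / (a + c) ≤ n / (a + c) - 2 * a / (a + c) ^ 2 := by
  have h1 : n / (a + c) - 2 * a / (a + c) ^ 2 - 1 / (a + c) =
      ((n - 3) * (a + c) + 2 * c) / (a + c) ^ 2 := by
    field_simp
    ring
  have h2 : 0 ≤ ((n - 3) * (a + c) + 2 * c) / (a + c) ^ 2 :=
    div_nonneg (add_nonneg (mul_nonneg (by linarith) hac.le) (by linarith)) (by positivity)
  linarith

/-- A Hardy-type inequality with regularized weight. -/
theorem integral_div_le_of_norm_fderiv_le {n : ℕ} (hn : 3 ≤ n)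
    (f : EuclideanSpace ℝ (Fin n) → ℝ) (g : EuclideanSpace ℝ (Fin n) → ℝ)
    (t : Set (EuclideanSpace ℝ (Fin n))) (ht : t.Countable)
    (hc : Continuous f) (hs : HasCompactSupport f) (hf0 : ∀ x, 0 ≤ f x) (hg0 : ∀ x, 0 ≤ g x)
    (hd : ∀ x ∉ t, DifferentiableAt ℝ f x)
    (hg : Integrable (fun x => g x ^ 2))
    (hfg : ∀ x ∉ t, ‖fderiv ℝ f x‖ ≤ 2 * √(f x) * g x)
    (x₀ : EuclideanSpace ℝ (Fin n)) {r : ℝ} (hr : 0 < r) :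
    ∫ x, f x / (‖x - x₀‖ ^ 2 + r ^ 2) ≤ 4 * ∫ x, g x ^ 2 := by
  have : NeZero n := ⟨by omega⟩
  have hpos : ∀ x, 0 < ‖x - x₀‖ ^ 2 + r ^ 2 := fun x => by positivity
  choose l hl hl1 using fun x i => hasFDerivAt_regularized_radial x₀ x hr i
  have hXc : ∀ i : Fin n, Continuous
      (fun z : EuclideanSpace ℝ (Fin n) => (z i - x₀ i) / (‖z - x₀‖ ^ 2 + r ^ 2)) := fun i =>
    continuous_iff_continuousAt.2 fun x => (hl x i).continuousAt
  have hae : ∀ᵐ x, x ∉ t := ht.ae_notMem volume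
  have hdiv : ∀ x, ∑ i, (f x • l x i + ((x i - x₀ i) / (‖x - x₀‖ ^ 2 + r ^ 2)) • fderiv ℝ f x)
      (EuclideanSpace.single i 1) =
      fderiv ℝ f x (x - x₀) / (‖x - x₀‖ ^ 2 + r ^ 2) +
        f x * (n / (‖x - x₀‖ ^ 2 + r ^ 2) -
          2 * ‖x - x₀‖ ^ 2 / (‖x - x₀‖ ^ 2 + r ^ 2) ^ 2) := by
    intro x
    have e1 := EuclideanSpace.sum_apply_single_mul (fderiv ℝ f x) (x - x₀)
    have e2 : ‖x - x₀‖ ^ 2 = ∑ i, (x i - x₀ i) ^ 2 := by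
      simp [EuclideanSpace.real_norm_sq_eq]
    have e3 : ∀ i, (f x • l x i + ((x i - x₀ i) / (‖x - x₀‖ ^ 2 + r ^ 2)) • fderiv ℝ f x)
      (EuclideanSpace.single i 1) =
        (fderiv ℝ f x (EuclideanSpace.single i 1) * (x - x₀) i) / (‖x - x₀‖ ^ 2 + r ^ 2) +
        (f x * (1 / (‖x - x₀‖ ^ 2 + r ^ 2)) -
          (x i - x₀ i) ^ 2 * (f x * (2 / (‖x - x₀‖ ^ 2 + r ^ 2) ^ 2))) := by
      intro i
      simp [hl1]
      ring
    simp_rw [e3]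
    rw [Finset.sum_add_distrib, Finset.sum_sub_distrib, ← Finset.sum_div, e1,
      Finset.sum_const, ← Finset.sum_mul, ← e2, Finset.card_univ, Fintype.card_fin, nsmul_eq_mul]
    ring
  have hyr : ∀ x, ‖x - x₀‖ ≤ √(‖x - x₀‖ ^ 2 + r ^ 2) := fun x =>
    Real.le_sqrt_of_sq_le (by nlinarith [sq_nonneg r])
  have hmix : ∀ x ∉ t, |fderiv ℝ f x (x - x₀) / (‖x - x₀‖ ^ 2 + r ^ 2)| ≤
      f x / (‖x - x₀‖ ^ 2 + r ^ 2) / 2 + 2 * g x ^ 2 := by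
    intro x hx
    have h1 : |fderiv ℝ f x (x - x₀)| ≤ 2 * √(f x) * g x * √(‖x - x₀‖ ^ 2 + r ^ 2) :=
      ((fderiv ℝ f x).le_opNorm _).trans
        (mul_le_mul (hfg x hx) (hyr x) (norm_nonneg _)
          (mul_nonneg (by positivity) (hg0 x)))
    rw [abs_div, abs_of_pos (hpos x)]
    set ρ := √(‖x - x₀‖ ^ 2 + r ^ 2) with hρ
    have hρ2 : ‖x - x₀‖ ^ 2 + r ^ 2 = ρ ^ 2 := (Real.sq_sqrt (hpos x).le).symm
    have hρ0 : 0 < ρ := Real.sqrt_pos.2 (hpos x)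
    have hf2 : f x = √(f x) ^ 2 := (Real.sq_sqrt (hf0 x)).symm
    rw [hρ2]
    calc |fderiv ℝ f x (x - x₀)| / ρ ^ 2 ≤ 2 * √(f x) * g x * ρ / ρ ^ 2 := by gcongr
      _ = 2 * (√(f x) / ρ) * g x := by field_simp
      _ ≤ (√(f x) / ρ) ^ 2 / 2 + 2 * g x ^ 2 := by
        nlinarith [sq_nonneg (√(f x) / ρ - 2 * g x)]
      _ = f x / ρ ^ 2 / 2 + 2 * g x ^ 2 := by rw [div_pow, ← hf2]
  have hwc : Continuous (fun x : EuclideanSpace ℝ (Fin n) => (‖x - x₀‖ ^ 2 + r ^ 2)) := by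
    fun_prop
  have hI0 : Integrable (fun x => f x / (‖x - x₀‖ ^ 2 + r ^ 2)) := by
    refine (hc.div hwc fun x => (hpos x).ne').integrable_of_hasCompactSupport ?_
    simp_rw [div_eq_mul_inv]
    exact hs.mul_right
  have hI1 : Integrable (fun x => fderiv ℝ f x (x - x₀) / (‖x - x₀‖ ^ 2 + r ^ 2)) := by
    refine Integrable.mono' ((hI0.div_const 2).add (hg.const_mul 2)) ?_ ?_
    · refine Measurable.aestronglyMeasurable (Measurable.div ?_ hwc.measurable)
      have : (fun x => fderiv ℝ f x (x - x₀)) =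
          fun x => ∑ i, fderiv ℝ f x (EuclideanSpace.single i 1) * (x - x₀) i := by
        funext x
        exact (EuclideanSpace.sum_apply_single_mul _ _).symm
      rw [this]
      refine Finset.measurable_sum _ fun i _ => ?_
      exact (measurable_fderiv_apply_const ℝ f _).mul
        (Continuous.measurable (by fun_prop))
    · filter_upwards [hae] with x hx
      exact hmix x hx
  have hI2 : Integrable (fun x => f x * (n / (‖x - x₀‖ ^ 2 + r ^ 2) -
          2 * ‖x - x₀‖ ^ 2 / (‖x - x₀‖ ^ 2 + r ^ 2) ^ 2)) := by
    refine (hc.mul (Continuous.sub (continuous_const.div hwc fun x => (hpos x).ne')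
      (Continuous.div (by fun_prop) (by fun_prop) fun x =>
        (pow_pos (hpos x) 2).ne'))).integrable_of_hasCompactSupport hs.mul_right
  have hsum := hI1.add hI2
  have hD : ∀ x ∉ t, ∀ i : Fin n,
      HasFDerivAt (fun z => f z * ((z i - x₀ i) / (‖z - x₀‖ ^ 2 + r ^ 2)))
        (f x • l x i + ((x i - x₀ i) / (‖x - x₀‖ ^ 2 + r ^ 2)) • fderiv ℝ f x) x :=
    fun x hx i => (hd x hx).hasFDerivAt.fun_mul (hl x i)
  have hDi : Integrable fun x =>
      ∑ i, (f x • l x i + ((x i - x₀ i) / (‖x - x₀‖ ^ 2 + r ^ 2)) • fderiv ℝ f x)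
        (EuclideanSpace.single i 1) := by
    refine hsum.congr (Eventually.of_forall fun x => ?_)
    exact (hdiv x).symm
  have hX0 : ∀ i : Fin n, HasCompactSupport
      (fun z => f z * ((z i - x₀ i) / (‖z - x₀‖ ^ 2 + r ^ 2))) := fun i => hs.mul_right
  have key := integral_divergence_eq_zero_of_hasCompactSupport (by omega) _ _ t ht
    (fun i => hc.mul (hXc i)) hX0 hD hDi
  simp_rw [hdiv] at key
  have hlow : ∫ x, (f x / (‖x - x₀‖ ^ 2 + r ^ 2) / 2 - 2 * g x ^ 2) ≤ 0 := by
    rw [← key]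
    refine integral_mono_ae ((hI0.div_const 2).sub (hg.const_mul 2)) hsum ?_
    filter_upwards [hae] with x hx
    have h1 := neg_le_of_abs_le (hmix x hx)
    have h2 : f x / (‖x - x₀‖ ^ 2 + r ^ 2) ≤ f x * (n / (‖x - x₀‖ ^ 2 + r ^ 2) -
          2 * ‖x - x₀‖ ^ 2 / (‖x - x₀‖ ^ 2 + r ^ 2) ^ 2) := by
      rw [div_eq_mul_one_div]
      refine mul_le_mul_of_nonneg_left ?_ (hf0 x)
      exact one_div_le_radial_divergence (by exact_mod_cast hn) (sq_nonneg r) (hpos x)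
    linarith
  rw [integral_sub (hI0.div_const 2) (hg.const_mul 2), integral_div, integral_const_mul] at hlow
  linarith

theorem hasDerivAt_max_zero_pow (m : ℕ) (z : ℝ) :
    HasDerivAt (fun z : ℝ => max z 0 ^ (m + 2)) ((m + 2 : ℕ) * max z 0 ^ (m + 1)) z := by
  rcases lt_trichotomy z 0 with hz | rfl | hz
  · have h1 : (fun z : ℝ => max z 0 ^ (m + 2)) =ᶠ[nhds z] fun _ => 0 := by
      filter_upwards [gt_mem_nhds hz] with y hy
      simp [max_eq_right hy.le]
    simpa [max_eq_right hz.le] using (hasDerivAt_const z (0 : ℝ)).congr_of_eventuallyEq h1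
  · have h1 : HasDerivAt (fun z : ℝ => z ^ (m + 2)) 0 0 := by
      simpa using hasDerivAt_pow (m + 2) (0 : ℝ)
    rw [hasDerivAt_iff_isLittleO] at h1 ⊢
    refine Asymptotics.IsLittleO.of_norm_left ?_
    refine Asymptotics.IsBigO.trans_isLittleO (Asymptotics.IsBigO.of_bound 1 ?_) h1
    refine Eventually.of_forall fun y => ?_
    have : |max y 0| ≤ |y| := by
      rw [abs_of_nonneg (le_max_right y 0)]
      exact max_le (le_abs_self y) (abs_nonneg y)
    simpa using pow_le_pow_left₀ (abs_nonneg _) this (m + 2)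
  · have h1 : (fun z : ℝ => max z 0 ^ (m + 2)) =ᶠ[nhds z] fun z => z ^ (m + 2) := by
      filter_upwards [lt_mem_nhds hz] with y hy
      simp [max_eq_left (le_of_lt hy)]
    simpa [max_eq_left hz.le] using (hasDerivAt_pow (m + 2) z).congr_of_eventuallyEq h1

theorem contDiff_max_zero_pow_three : ContDiff ℝ 2 (fun z : ℝ => max z 0 ^ 3) := by
  have h2 : ContDiff ℝ 1 (fun z : ℝ => max z 0 ^ 2) := by
    refine contDiff_one_iff_deriv.2 ⟨fun z => (hasDerivAt_max_zero_pow 0 z).differentiableAt, ?_⟩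
    rw [show deriv (fun z : ℝ => max z 0 ^ 2) = fun z => ((0 + 2 : ℕ) : ℝ) * max z 0 ^ (0 + 1) from
      funext fun z => (hasDerivAt_max_zero_pow 0 z).deriv]
    fun_prop
  rw [show (2 : WithTop ℕ∞) = 1 + 1 from (one_add_one_eq_two).symm, contDiff_succ_iff_deriv]
  refine ⟨fun z => (hasDerivAt_max_zero_pow 1 z).differentiableAt, by simp, ?_⟩
  rw [show deriv (fun z : ℝ => max z 0 ^ 3) = fun z => ((1 + 2 : ℕ) : ℝ) * max z 0 ^ (1 + 1) from
      funext fun z => (hasDerivAt_max_zero_pow 1 z).deriv]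
  exact contDiff_const.mul h2

/-- The radial averaging kernel `(1 - ‖y‖²)₊²`. -/
noncomputable def averagingKernel {n : ℕ} (y : EuclideanSpace ℝ (Fin n)) : ℝ :=
  max (1 - ‖y‖ ^ 2) 0 ^ 2

/-- The kernel `(1 - ‖y‖²)₊³ / 6`, with gradient `-averagingKernel y • y`. -/
noncomputable def averagingPrimitive {n : ℕ} (y : EuclideanSpace ℝ (Fin n)) : ℝ :=
  max (1 - ‖y‖ ^ 2) 0 ^ 3 / 6

theorem continuous_averagingKernel {n : ℕ} :
    Continuous (averagingKernel : EuclideanSpace ℝ (Fin n) → ℝ) := by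
  unfold averagingKernel; fun_prop

theorem continuous_averagingPrimitive {n : ℕ} :
    Continuous (averagingPrimitive : EuclideanSpace ℝ (Fin n) → ℝ) := by
  unfold averagingPrimitive; fun_prop

theorem max_one_sub_norm_sq_eq_zero {n : ℕ} {y : EuclideanSpace ℝ (Fin n)} (hy : 1 ≤ ‖y‖) :
    max (1 - ‖y‖ ^ 2) 0 = 0 :=
  max_eq_right (by nlinarith)

theorem averagingKernel_eq_zero {n : ℕ} {y : EuclideanSpace ℝ (Fin n)} (hy : 1 ≤ ‖y‖) :
    averagingKernel y = 0 := by
  simp [averagingKernel, max_one_sub_norm_sq_eq_zero hy]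

theorem averagingPrimitive_eq_zero {n : ℕ} {y : EuclideanSpace ℝ (Fin n)} (hy : 1 ≤ ‖y‖) :
    averagingPrimitive y = 0 := by
  simp [averagingPrimitive, max_one_sub_norm_sq_eq_zero hy]

theorem averagingKernel_nonneg {n : ℕ} (y : EuclideanSpace ℝ (Fin n)) : 0 ≤ averagingKernel y := by
  unfold averagingKernel; positivity

theorem averagingPrimitive_nonneg {n : ℕ} (y : EuclideanSpace ℝ (Fin n)) :
    0 ≤ averagingPrimitive y := by
  unfold averagingPrimitive; positivity

theorem averagingKernel_le_one {n : ℕ} (y : EuclideanSpace ℝ (Fin n)) :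
    averagingKernel y ≤ 1 :=
  pow_le_one₀ (le_max_right _ _) (max_le (by nlinarith [sq_nonneg ‖y‖]) zero_le_one)

theorem hasCompactSupport_averagingKernel {n : ℕ} :
    HasCompactSupport (averagingKernel : EuclideanSpace ℝ (Fin n) → ℝ) :=
  HasCompactSupport.intro (isCompact_closedBall 0 1) fun y hy =>
    averagingKernel_eq_zero (by
      rw [mem_closedBall_zero_iff, not_le] at hy
      exact hy.le)

theorem hasCompactSupport_averagingPrimitive {n : ℕ} :
    HasCompactSupport (averagingPrimitive : EuclideanSpace ℝ (Fin n) → ℝ) :=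
  HasCompactSupport.intro (isCompact_closedBall 0 1) fun y hy =>
    averagingPrimitive_eq_zero (by
      rw [mem_closedBall_zero_iff, not_le] at hy
      exact hy.le)

theorem hasFDerivAt_averagingPrimitive {n : ℕ} (y : EuclideanSpace ℝ (Fin n)) :
    HasFDerivAt averagingPrimitive (-(averagingKernel y) • innerSL ℝ y) y := by
  have h1 := ((hasFDerivAt_id y).norm_sq).const_sub 1
  have h2 := ((hasDerivAt_max_zero_pow 1 (1 - ‖y‖ ^ 2)).div_const 6).comp_hasFDerivAt y h1
  refine h2.congr_fderiv ?_
  ext v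
  simp [averagingKernel]
  ring

theorem integral_averagingKernel_pos {n : ℕ} :
    0 < ∫ y : EuclideanSpace ℝ (Fin n), averagingKernel y :=
  continuous_averagingKernel.integral_pos_of_hasCompactSupport_nonneg_nonzero
    hasCompactSupport_averagingKernel averagingKernel_nonneg (x := 0)
    (by simp [averagingKernel])

/-- Mean value inequality for functions with Laplacian bounded below. -/
theorem mul_integral_averagingKernel_le {n : ℕ} (hn : n ≠ 0) (w : EuclideanSpace ℝ (Fin n) → ℝ)
    (hw : ContDiff ℝ 2 w) (hws : HasCompactSupport w) (x₀ : EuclideanSpace ℝ (Fin n))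
    {r G : ℝ} (hr : 0 < r) (hG : ∀ x, ‖x - x₀‖ < r → -G ≤ lap n w x) :
    w x₀ * ∫ y : EuclideanSpace ℝ (Fin n), averagingKernel y ≤
      (∫ y, averagingKernel y * w (x₀ + r • y)) +
        G * r ^ 2 / 2 * ∫ y : EuclideanSpace ℝ (Fin n), averagingPrimitive y := by
  have hw1 : ContDiff ℝ 1 (fderiv ℝ w) := hw.fderiv_right (by norm_num [one_add_one_eq_two])
  have hwd : Differentiable ℝ w := hw.differentiable (by norm_num)
  have hwp : ∀ i : Fin n, ContDiff ℝ 1 (fun x => fderiv ℝ w x (EuclideanSpace.single i 1)) :=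
    fun i => hw1.clm_apply contDiff_const
  have hlapc : Continuous (lap n w) := by
    unfold lap
    refine continuous_finsetSum _ fun i _ => ?_
    exact ((hwp i).continuous_fderiv (by norm_num)).clm_apply continuous_const
  obtain ⟨M, hM⟩ := hw1.continuous.bounded_above_of_compact_support (hws.fderiv ℝ)
  set φ : EuclideanSpace ℝ (Fin n) → ℝ := averagingKernel
  set ψ : EuclideanSpace ℝ (Fin n) → ℝ := averagingPrimitive
  have hφc : Continuous φ := continuous_averagingKernel
  have hψc : Continuous ψ := continuous_averagingPrimitive
  have hφs : HasCompactSupport φ := hasCompactSupport_averagingKernel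
  have hψs : HasCompactSupport ψ := hasCompactSupport_averagingPrimitive
  have hM0 : 0 ≤ M := (norm_nonneg _).trans (hM 0)
  have haffc : ∀ t : ℝ, Continuous fun y : EuclideanSpace ℝ (Fin n) => x₀ + t • y := fun t => by
    fun_prop
  -- differentiation under the integral sign
  have hderiv : ∀ t : ℝ, HasDerivAt (fun t : ℝ => ∫ y, φ y * w (x₀ + t • y))
      (∫ y, φ y * fderiv ℝ w (x₀ + t • y) y) t := by
    intro t
    refine (hasDerivAt_integral_of_dominated_loc_of_deriv_le (μ := volume) (s := univ)
      (F := fun t y => φ y * w (x₀ + t • y))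
      (F' := fun t y => φ y * fderiv ℝ w (x₀ + t • y) y)
      (bound := fun y => φ y * M) univ_mem ?_ ?_ ?_ ?_ ?_ ?_).2
    · refine Eventually.of_forall fun τ => Continuous.aestronglyMeasurable ?_
      exact hφc.mul (hw.continuous.comp (haffc τ))
    · exact (hφc.mul (hw.continuous.comp (haffc t))).integrable_of_hasCompactSupport
        hφs.mul_right
    · refine Continuous.aestronglyMeasurable ?_
      exact hφc.mul ((hw1.continuous.comp (haffc t)).clm_apply continuous_id)
    · refine Eventually.of_forall fun y τ _ => ?_
      rw [norm_mul, Real.norm_of_nonneg (averagingKernel_nonneg y)]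
      by_cases hy : 1 ≤ ‖y‖
      · simp [φ, averagingKernel_eq_zero hy]
      · refine mul_le_mul_of_nonneg_left ?_ (averagingKernel_nonneg y)
        refine ((fderiv ℝ w (x₀ + τ • y)).le_opNorm y).trans ?_
        calc _ ≤ M * 1 := mul_le_mul (hM _) (not_le.1 hy).le (norm_nonneg _) hM0
          _ = M := mul_one M
    · exact (hφc.integrable_of_hasCompactSupport hφs).mul_const M
    · refine Eventually.of_forall fun y τ _ => ?_
      refine HasDerivAt.const_mul _ ?_
      have h1 : HasDerivAt (fun τ : ℝ => x₀ + τ • y) y τ := by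
        simpa using ((hasDerivAt_id τ).smul_const y).const_add x₀
      exact (hwd (x₀ + τ • y)).hasFDerivAt.comp_hasDerivAt τ h1
  -- integration by parts
  have hibp : ∀ t : ℝ, ∫ y, φ y * fderiv ℝ w (x₀ + t • y) y =
      t * ∫ y, ψ y * lap n w (x₀ + t • y) := by
    intro t
    have haff : ∀ y : EuclideanSpace ℝ (Fin n), HasFDerivAt (fun y => x₀ + t • y)
        (t • ContinuousLinearMap.id ℝ (EuclideanSpace ℝ (Fin n))) y := fun y =>
      ((hasFDerivAt_id y).const_smul t).const_add x₀
    have hpd : ∀ (y : EuclideanSpace ℝ (Fin n)) (i : Fin n), HasFDerivAt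
        (fun y => fderiv ℝ w (x₀ + t • y) (EuclideanSpace.single i 1))
        ((fderiv ℝ (fun z => fderiv ℝ w z (EuclideanSpace.single i 1)) (x₀ + t • y)).comp
          (t • ContinuousLinearMap.id ℝ (EuclideanSpace ℝ (Fin n)))) y := fun y i =>
      HasFDerivAt.comp y (g := fun z => fderiv ℝ w z (EuclideanSpace.single i 1))
        (((hwp i).differentiable (by norm_num)) (x₀ + t • y)).hasFDerivAt (haff y)
    have hY : ∀ y ∉ (∅ : Set (EuclideanSpace ℝ (Fin n))), ∀ i : Fin n, HasFDerivAt
        (fun y => ψ y * fderiv ℝ w (x₀ + t • y) (EuclideanSpace.single i 1))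
        (ψ y • ((fderiv ℝ (fun z => fderiv ℝ w z (EuclideanSpace.single i 1)) (x₀ + t • y)).comp
          (t • ContinuousLinearMap.id ℝ (EuclideanSpace ℝ (Fin n)))) +
          fderiv ℝ w (x₀ + t • y) (EuclideanSpace.single i 1) • (-(φ y) • innerSL ℝ y)) y :=
      fun y _ i => (hasFDerivAt_averagingPrimitive y).fun_mul (hpd y i)
    have hdiv : ∀ y, ∑ i : Fin n,
        (ψ y • ((fderiv ℝ (fun z => fderiv ℝ w z (EuclideanSpace.single i 1)) (x₀ + t • y)).comp
          (t • ContinuousLinearMap.id ℝ (EuclideanSpace ℝ (Fin n)))) +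
          fderiv ℝ w (x₀ + t • y) (EuclideanSpace.single i 1) • (-(φ y) • innerSL ℝ y))
            (EuclideanSpace.single i 1) =
        t * (ψ y * lap n w (x₀ + t • y)) - φ y * fderiv ℝ w (x₀ + t • y) y := by
      intro y
      have e1 := EuclideanSpace.sum_apply_single_mul (fderiv ℝ w (x₀ + t • y)) y
      rw [← e1, lap, Finset.mul_sum, Finset.mul_sum, Finset.mul_sum, ← Finset.sum_sub_distrib]
      refine Finset.sum_congr rfl fun i _ => ?_
      simp [EuclideanSpace.inner_single_right]
      ring
    have hI1 : Integrable (fun y => ψ y * lap n w (x₀ + t • y)) :=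
      (hψc.mul (hlapc.comp (haffc t))).integrable_of_hasCompactSupport hψs.mul_right
    have hI2 : Integrable (fun y => φ y * fderiv ℝ w (x₀ + t • y) y) :=
      (hφc.mul ((hw1.continuous.comp (haffc t)).clm_apply
        continuous_id)).integrable_of_hasCompactSupport hφs.mul_right
    have hYi := ((hI1.const_mul t).sub hI2).congr
      (Eventually.of_forall fun y => (hdiv y).symm)
    have hYc : ∀ i : Fin n, Continuous
        (fun y => ψ y * fderiv ℝ w (x₀ + t • y) (EuclideanSpace.single i 1)) := fun i =>
      hψc.mul ((hwp i).continuous.comp (haffc t))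
    have hYs : ∀ i : Fin n, HasCompactSupport
        (fun y => ψ y * fderiv ℝ w (x₀ + t • y) (EuclideanSpace.single i 1)) := fun i =>
      hψs.mul_right
    have key := integral_divergence_eq_zero_of_hasCompactSupport hn _ _ ∅ countable_empty
      hYc hYs hY hYi
    simp_rw [hdiv] at key
    rw [integral_sub (hI1.const_mul t) hI2, integral_const_mul] at key
    linarith
  have hmono : MonotoneOn (fun t : ℝ => (∫ y, φ y * w (x₀ + t • y)) + G * t ^ 2 / 2 * ∫ y, ψ y)
      (Icc 0 r) := by
    have hd : ∀ t : ℝ, HasDerivAt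
        (fun t : ℝ => (∫ y, φ y * w (x₀ + t • y)) + G * t ^ 2 / 2 * ∫ y, ψ y)
        ((∫ y, φ y * fderiv ℝ w (x₀ + t • y) y) + G * t * ∫ y, ψ y) t := by
      intro t
      refine (hderiv t).add (HasDerivAt.mul_const ?_ _)
      refine (((hasDerivAt_pow 2 t).const_mul G).div_const 2).congr_deriv ?_
      push_cast
      ring
    refine monotoneOn_of_deriv_nonneg (convex_Icc 0 r)
      (fun t _ => (hd t).continuousAt.continuousWithinAt)
      (fun t _ => (hd t).differentiableAt.differentiableWithinAt) fun t ht => ?_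
    rw [interior_Icc] at ht
    rw [(hd t).deriv, hibp t]
    have hI1 : Integrable (fun y => ψ y * lap n w (x₀ + t • y)) :=
      (hψc.mul (hlapc.comp (haffc t))).integrable_of_hasCompactSupport hψs.mul_right
    have hlow : -G * ∫ y, ψ y ≤ ∫ y, ψ y * lap n w (x₀ + t • y) := by
      rw [← integral_const_mul]
      refine integral_mono ((hψc.integrable_of_hasCompactSupport hψs).const_mul _) hI1 fun y => ?_
      by_cases hy : 1 ≤ ‖y‖
      · simp [ψ, averagingPrimitive_eq_zero hy]
      · have h1 : ‖x₀ + t • y - x₀‖ < r := by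
          rw [add_sub_cancel_left, norm_smul, Real.norm_of_nonneg ht.1.le]
          nlinarith [ht.1, ht.2, norm_nonneg y]
        have h2 := mul_le_mul_of_nonneg_left (hG _ h1) (averagingPrimitive_nonneg y)
        simp only [ψ]
        linarith
    nlinarith [mul_le_mul_of_nonneg_left hlow ht.1.le]
  have hfin := hmono (left_mem_Icc.2 hr.le) (right_mem_Icc.2 hr.le) hr.le
  simp only [zero_smul, add_zero, ne_eq, OfNat.ofNat_ne_zero, not_false_eq_true, zero_pow, mul_zero,
    zero_div, zero_mul, integral_mul_const] at hfin
  linarith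

theorem lap_congr {n : ℕ} {u v : EuclideanSpace ℝ (Fin n) → ℝ} {x : EuclideanSpace ℝ (Fin n)}
    (h : u =ᶠ[nhds x] v) : lap n u x = lap n v x := by
  unfold lap
  refine Finset.sum_congr rfl fun i _ => ?_
  have h1 : (fun y => fderiv ℝ u y (EuclideanSpace.single i 1)) =ᶠ[nhds x]
      fun y => fderiv ℝ v y (EuclideanSpace.single i 1) :=
    h.fderiv.fun_comp fun l => l (EuclideanSpace.single i 1)
  rw [h1.fderiv_eq]

/-- The cubed positive part of `u - k` has Laplacian at least `3 (u - k)₊² Δu`. -/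
theorem mul_lap_le_lap_max_pow_three {n : ℕ} {u : EuclideanSpace ℝ (Fin n) → ℝ}
    {x : EuclideanSpace ℝ (Fin n)} (hu : ContDiffAt ℝ 2 u x) (k : ℝ) :
    3 * max (u x - k) 0 ^ 2 * lap n u x ≤ lap n (fun y => max (u y - k) 0 ^ 3) x := by
  have hu1 : ContDiffAt ℝ 1 (fderiv ℝ u) x :=
    hu.fderiv_right (by norm_num [one_add_one_eq_two])
  have hev : ∀ᶠ y in nhds x, DifferentiableAt ℝ u y := by
    filter_upwards [hu.eventually (by simp)] with y hy
    exact hy.differentiableAt (by norm_num)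
  unfold lap
  rw [Finset.mul_sum]
  refine Finset.sum_le_sum fun i _ => ?_
  set e : EuclideanSpace ℝ (Fin n) := EuclideanSpace.single i 1
  have h1 : (fun y => fderiv ℝ (fun z => max (u z - k) 0 ^ 3) y e) =ᶠ[nhds x]
      fun y => 3 * max (u y - k) 0 ^ 2 * fderiv ℝ u y e := by
    filter_upwards [hev] with y hy
    have h2 := (hasDerivAt_max_zero_pow 1 (u y - k)).comp_hasFDerivAt y (hy.hasFDerivAt.sub_const k)
    have h3 : fderiv ℝ (fun z => max (u z - k) 0 ^ 3) y = _ := h2.fderiv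
    rw [h3]
    simp
  rw [h1.fderiv_eq]
  have h4 : HasFDerivAt (fun y => 3 * max (u y - k) 0 ^ 2)
      ((3 * (2 * max (u x - k) 0)) • fderiv ℝ u x) x := by
    have := ((hasDerivAt_max_zero_pow 0 (u x - k)).comp_hasFDerivAt x
      (hev.self_of_nhds.hasFDerivAt.sub_const k)).const_mul 3
    refine this.congr_fderiv ?_
    simp [smul_smul]
  have h5 : HasFDerivAt (fun y => fderiv ℝ u y e) (fderiv ℝ (fun y => fderiv ℝ u y e) x) x :=
    ((hu1.differentiableAt (by norm_num)).clm_apply (differentiableAt_const e)).hasFDerivAt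
  rw [(h4.fun_mul h5).fderiv]
  have h6 : 0 ≤ max (u x - k) 0 * fderiv ℝ u x e ^ 2 :=
    mul_nonneg (le_max_right _ _) (sq_nonneg _)
  simp only [add_apply, smul_apply, smul_eq_mul]
  nlinarith

/-- The positive part of `u - k` on `Ω`, extended by zero. -/
noncomputable def truncation {n : ℕ} (Ω : Set (EuclideanSpace ℝ (Fin n)))
    (u : EuclideanSpace ℝ (Fin n) → ℝ) (k : ℝ) : EuclideanSpace ℝ (Fin n) → ℝ :=
  Ω.indicator fun x => max (u x - k) 0

section Truncation

variable {n : ℕ} {Ω : Set (EuclideanSpace ℝ (Fin n))} {u : EuclideanSpace ℝ (Fin n) → ℝ} {k : ℝ}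

theorem truncation_nonneg (x : EuclideanSpace ℝ (Fin n)) : 0 ≤ truncation Ω u k x :=
  indicator_nonneg (fun _ _ => le_max_right _ _) x

theorem truncation_eventuallyEq (hΩ : IsOpen Ω) {x : EuclideanSpace ℝ (Fin n)} (hx : x ∈ Ω) :
    truncation Ω u k =ᶠ[nhds x] fun y => max (u y - k) 0 := by
  filter_upwards [hΩ.mem_nhds hx] with y hy
  exact indicator_of_mem hy _

theorem truncation_eventuallyEq_zero (hΩ : IsOpen Ω) (hu : ContinuousOn u (closure Ω))
    (hu0 : ∀ x ∈ frontier Ω, u x = 0) (hk : 0 < k) {x : EuclideanSpace ℝ (Fin n)} (hx : x ∉ Ω) :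
    truncation Ω u k =ᶠ[nhds x] fun _ => 0 := by
  by_cases hxc : x ∈ closure Ω
  · have hxf : x ∈ frontier Ω := ⟨hxc, by rwa [hΩ.interior_eq]⟩
    have h1 : ∀ᶠ y in nhdsWithin x (closure Ω), u y < k :=
      (hu x hxc).eventually_lt_const (by rw [hu0 x hxf]; exact hk)
    filter_upwards [eventually_nhdsWithin_iff.1 h1] with y hy
    by_cases hyΩ : y ∈ Ω
    · rw [truncation, indicator_of_mem hyΩ]
      exact max_eq_right (by linarith [hy (subset_closure hyΩ)])
    · exact indicator_of_notMem hyΩ _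
  · filter_upwards [isClosed_closure.isOpen_compl.mem_nhds hxc] with y hy
    exact indicator_of_notMem (fun h => hy (subset_closure h)) _

theorem continuous_truncation (hΩ : IsOpen Ω) (hu : ContinuousOn u (closure Ω))
    (hu0 : ∀ x ∈ frontier Ω, u x = 0) (hk : 0 < k) : Continuous (truncation Ω u k) := by
  refine continuous_iff_continuousAt.2 fun x => ?_
  by_cases hx : x ∈ Ω
  · have h1 : ContinuousAt u x := hu.continuousAt (mem_of_superset (hΩ.mem_nhds hx) subset_closure)
    have h2 : ContinuousAt (fun y => max (u y - k) 0) x :=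
      (h1.sub continuousAt_const).max continuousAt_const
    exact h2.congr_of_eventuallyEq (truncation_eventuallyEq hΩ hx)
  · exact continuousAt_const.congr_of_eventuallyEq
      (truncation_eventuallyEq_zero hΩ hu hu0 hk hx)

theorem hasCompactSupport_truncation (hb : Bornology.IsBounded Ω) :
    HasCompactSupport (truncation Ω u k) :=
  HasCompactSupport.intro hb.isCompact_closure fun _ hx =>
    indicator_of_notMem (fun h => hx (subset_closure h)) _

theorem integral_truncation_sq_div_le (hn : 3 ≤ n) (hΩ : IsOpen Ω) (hb : Bornology.IsBounded Ω)
    (hu : ContinuousOn u (closure Ω)) (hud : ContDiffOn ℝ 2 u (closure Ω \ {0}))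
    (hui : IntegrableOn (fun x => ‖fderiv ℝ u x‖ ^ 2) Ω) (hu0 : ∀ x ∈ frontier Ω, u x = 0)
    (hk : 0 < k) (x₀ : EuclideanSpace ℝ (Fin n)) {r : ℝ} (hr : 0 < r) :
    ∫ x, truncation Ω u k x ^ 2 / (‖x - x₀‖ ^ 2 + r ^ 2) ≤
      4 * ∫ x in Ω, ‖fderiv ℝ u x‖ ^ 2 := by
  have hg2 : (fun x => Ω.indicator (fun x => ‖fderiv ℝ u x‖) x ^ 2) =
      Ω.indicator fun x => ‖fderiv ℝ u x‖ ^ 2 := by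
    funext x
    by_cases hx : x ∈ Ω <;> simp [hx]
  have hder : ∀ x ∉ ({0} : Set (EuclideanSpace ℝ (Fin n))),
      ∃ l : EuclideanSpace ℝ (Fin n) →L[ℝ] ℝ,
        HasFDerivAt (fun x => truncation Ω u k x ^ 2) l x ∧
        ‖l‖ ≤ 2 * √(truncation Ω u k x ^ 2) * Ω.indicator (fun x => ‖fderiv ℝ u x‖) x := by
    intro x hx0
    rw [Real.sqrt_sq (truncation_nonneg x)]
    by_cases hx : x ∈ Ω
    · have hmem : closure Ω \ {0} ∈ nhds x :=
        mem_of_superset ((hΩ.sdiff isClosed_singleton).mem_nhds ⟨hx, hx0⟩)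
          (sdiff_subset_sdiff_left subset_closure)
      have h1 : DifferentiableAt ℝ u x := (hud.contDiffAt hmem).differentiableAt (by norm_num)
      have h2 := (hasDerivAt_max_zero_pow 0 (u x - k)).comp_hasFDerivAt x
        (h1.hasFDerivAt.sub_const k)
      refine ⟨_, h2.congr_of_eventuallyEq ?_, ?_⟩
      · filter_upwards [truncation_eventuallyEq (u := u) (k := k) hΩ hx] with y hy
        simp [hy]
      · rw [norm_smul, indicator_of_mem hx, truncation, indicator_of_mem hx]
        simp [abs_of_nonneg (le_max_right (u x - k) 0)]
    · refine ⟨0, (hasFDerivAt_const (0 : ℝ) x).congr_of_eventuallyEq ?_, ?_⟩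
      · filter_upwards [truncation_eventuallyEq_zero hΩ hu hu0 hk hx] with y hy
        simp [hy]
      · simp [hx]
  have key := integral_div_le_of_norm_fderiv_le hn (fun x => truncation Ω u k x ^ 2)
    (Ω.indicator fun x => ‖fderiv ℝ u x‖) {0} (countable_singleton 0)
    ((continuous_truncation hΩ hu hu0 hk).pow 2)
    ((hasCompactSupport_truncation hb).comp_left (g := fun z : ℝ => z ^ 2) (by norm_num))
    (fun x => sq_nonneg _) (indicator_nonneg fun _ _ => norm_nonneg _)
    (fun x hx => (hder x hx).choose_spec.1.differentiableAt)
    (by rw [hg2]; exact (integrable_indicator_iff hΩ.measurableSet).2 hui)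
    (fun x hx => by
      rw [(hder x hx).choose_spec.1.fderiv]
      exact (hder x hx).choose_spec.2)
    x₀ hr
  rwa [hg2, integral_indicator hΩ.measurableSet] at key

/-- Local pointwise estimate for functions vanishing on the boundary. -/
theorem pow_three_le_of_lap_lower_bound (hn : 3 ≤ n) (hΩ : IsOpen Ω) (hb : Bornology.IsBounded Ω)
    (hu : ContinuousOn u (closure Ω)) (hud : ContDiffOn ℝ 2 u (closure Ω \ {0}))
    (hui : IntegrableOn (fun x => ‖fderiv ℝ u x‖ ^ 2) Ω) (hu0 : ∀ x ∈ frontier Ω, u x = 0)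
    (hk : 0 < k) {x₀ : EuclideanSpace ℝ (Fin n)} (hx₀ : x₀ ∈ Ω) {r G M : ℝ} (hr : 0 < r)
    (hrx : 2 * r < ‖x₀‖) (hG0 : 0 ≤ G) (hM0 : 0 ≤ M)
    (hM : ∀ x ∈ Ω, ‖x - x₀‖ < r → u x ≤ M)
    (hG : ∀ x ∈ Ω, ‖x - x₀‖ < r → -G ≤ 3 * max (u x - k) 0 ^ 2 * lap n u x) :
    max (u x₀ - k) 0 ^ 3 * ∫ y : EuclideanSpace ℝ (Fin n), averagingKernel y ≤
      8 * M * (∫ x in Ω, ‖fderiv ℝ u x‖ ^ 2) * (r ^ 2 / r ^ n) +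
        G * r ^ 2 / 2 * ∫ y : EuclideanSpace ℝ (Fin n), averagingPrimitive y := by
  let χ : ContDiffBump x₀ := ⟨r, 2 * r, hr, by linarith⟩
  have h0χ : (0 : EuclideanSpace ℝ (Fin n)) ∉ tsupport χ := by
    rw [χ.tsupport_eq, Metric.mem_closedBall, dist_comm, dist_zero_right]
    exact not_le.2 hrx
  have hnhds : ∀ x ∈ Ω, x ≠ 0 → ContDiffAt ℝ 2 u x := fun x hx hx0 =>
    hud.contDiffAt (mem_of_superset ((hΩ.sdiff isClosed_singleton).mem_nhds ⟨hx, hx0⟩)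
      (sdiff_subset_sdiff_left subset_closure))
  set w : EuclideanSpace ℝ (Fin n) → ℝ := fun x => χ x * truncation Ω u k x ^ 3 with hw
  have hwc : ContDiff ℝ 2 w := by
    refine contDiff_iff_contDiffAt.2 fun x => ?_
    by_cases hx : x ∈ Ω
    · by_cases hx0 : x = 0
      · have h1 : w =ᶠ[nhds x] fun _ => 0 := by
          rw [hx0]
          filter_upwards [notMem_tsupport_iff_eventuallyEq.1 h0χ] with y hy
          simp [hw, hy]
        exact contDiffAt_const.congr_of_eventuallyEq h1
      · refine χ.contDiff.contDiffAt.mul ?_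
        have h1 : ContDiffAt ℝ 2 (fun y => max (u y - k) 0 ^ 3) x :=
          contDiff_max_zero_pow_three.contDiffAt.comp x ((hnhds x hx hx0).sub contDiffAt_const)
        refine h1.congr_of_eventuallyEq ?_
        filter_upwards [truncation_eventuallyEq (u := u) (k := k) hΩ hx] with y hy
        rw [hy]
    · have h1 : w =ᶠ[nhds x] fun _ => 0 := by
        filter_upwards [truncation_eventuallyEq_zero hΩ hu hu0 hk hx] with y hy
        simp [hw, hy]
      exact contDiffAt_const.congr_of_eventuallyEq h1
  have hws : HasCompactSupport w := χ.hasCompactSupport.mul_right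
  have hχ1 : ∀ x, ‖x - x₀‖ < r → χ =ᶠ[nhds x] 1 := fun x hx =>
    χ.eventuallyEq_one_of_mem_ball (by rwa [Metric.mem_ball, dist_eq_norm])
  have hlap : ∀ x, ‖x - x₀‖ < r → -G ≤ lap n w x := by
    intro x hx
    by_cases hxΩ : x ∈ Ω
    · have hx0 : x ≠ 0 := by
        rintro rfl
        rw [zero_sub, norm_neg] at hx
        linarith
      have h1 : w =ᶠ[nhds x] fun y => max (u y - k) 0 ^ 3 := by
        filter_upwards [truncation_eventuallyEq (u := u) (k := k) hΩ hxΩ, hχ1 x hx] with y hy hy1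
        simp [hw, hy, hy1]
      rw [lap_congr h1]
      exact (hG x hxΩ hx).trans (mul_lap_le_lap_max_pow_three (hnhds x hxΩ hx0) k)
    · have h1 : w =ᶠ[nhds x] fun _ => 0 := by
        filter_upwards [truncation_eventuallyEq_zero hΩ hu hu0 hk hxΩ] with y hy
        simp [hw, hy]
      rw [lap_congr h1]
      simpa [lap] using hG0
  have key := mul_integral_averagingKernel_le (by omega) w hwc hws x₀ hr hlap
  have hwx₀ : w x₀ = max (u x₀ - k) 0 ^ 3 := by
    have h1 := (hχ1 x₀ (by simpa using hr)).self_of_nhds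
    have h2 := (truncation_eventuallyEq (u := u) (k := k) hΩ hx₀).self_of_nhds
    simp only [hw, h1, h2, Pi.one_apply, one_mul]
  rw [hwx₀] at key
  refine key.trans (add_le_add_left ?_ _)
  set H : EuclideanSpace ℝ (Fin n) → ℝ :=
    fun x => truncation Ω u k x ^ 2 / (‖x - x₀‖ ^ 2 + r ^ 2) with hH
  have hpos : ∀ x, 0 < ‖x - x₀‖ ^ 2 + r ^ 2 := fun x => by positivity
  have htc := continuous_truncation (k := k) hΩ hu hu0 hk
  have hHc : Continuous H :=
    (htc.pow 2).div (by fun_prop) fun x => (hpos x).ne'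
  have hHs : HasCompactSupport H := by
    have h1 : HasCompactSupport (fun x => truncation Ω u k x ^ 2) :=
      (hasCompactSupport_truncation hb).comp_left (g := fun z : ℝ => z ^ 2) (by norm_num)
    simp_rw [hH, div_eq_mul_inv]
    exact h1.mul_right
  have haff : Continuous fun y : EuclideanSpace ℝ (Fin n) => x₀ + r • y := by fun_prop
  have hcomp : ∫ y, H (x₀ + r • y) = (r ^ n)⁻¹ * ∫ x, H x := by
    have h1 := Measure.integral_comp_smul volume (fun y => H (x₀ + y)) r
    rw [h1, integral_add_left_eq_self H x₀, finrank_euclideanSpace_fin,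
      abs_of_pos (by positivity), smul_eq_mul]
  have hHi : Integrable fun y => H (x₀ + r • y) := by
    have h1 : Integrable fun y => H (x₀ + y) :=
      (hHc.integrable_of_hasCompactSupport hHs).comp_add_left x₀
    exact h1.comp_smul hr.ne'
  have hle : ∀ y, averagingKernel y * w (x₀ + r • y) ≤ (2 * r ^ 2 * M) * H (x₀ + r • y) := by
    intro y
    have hHn : 0 ≤ H (x₀ + r • y) := div_nonneg (sq_nonneg _) (hpos _).le
    by_cases hy : 1 ≤ ‖y‖
    · rw [averagingKernel_eq_zero hy, zero_mul]
      positivity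
    · set x := x₀ + r • y with hx
      have hxr : ‖x - x₀‖ < r := by
        rw [hx, add_sub_cancel_left, norm_smul, Real.norm_of_nonneg hr.le]
        nlinarith
      have htn := truncation_nonneg (Ω := Ω) (u := u) (k := k) x
      have htM : truncation Ω u k x ≤ M := by
        by_cases hxΩ : x ∈ Ω
        · rw [truncation, indicator_of_mem hxΩ]
          exact max_le (by linarith [hM x hxΩ hxr]) hM0
        · rw [truncation, indicator_of_notMem hxΩ]
          exact hM0
      have hwx : w x = truncation Ω u k x ^ 3 := by
        simp only [hw, (hχ1 x hxr).self_of_nhds, Pi.one_apply, one_mul]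
      have hw0 : 0 ≤ w x := by rw [hwx]; positivity
      have hsq : truncation Ω u k x ^ 2 ≤ 2 * r ^ 2 * H x := by
        rw [hH]
        simp only
        rw [mul_div_assoc', le_div_iff₀ (hpos x)]
        nlinarith [norm_nonneg (x - x₀), sq_nonneg (truncation Ω u k x),
          mul_nonneg (sq_nonneg (truncation Ω u k x))
            (sub_nonneg.2 (pow_le_pow_left₀ (norm_nonneg (x - x₀)) hxr.le 2))]
      calc averagingKernel y * w x ≤ 1 * w x :=
            mul_le_mul_of_nonneg_right (averagingKernel_le_one y) hw0
        _ = truncation Ω u k x * truncation Ω u k x ^ 2 := by rw [hwx]; ring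
        _ ≤ M * (2 * r ^ 2 * H x) := mul_le_mul htM hsq (sq_nonneg _) hM0
        _ = _ := by ring
  have hint : Integrable fun y => averagingKernel y * w (x₀ + r • y) :=
    (continuous_averagingKernel.mul (hwc.continuous.comp haff)).integrable_of_hasCompactSupport
      hasCompactSupport_averagingKernel.mul_right
  have h1 := integral_mono hint (hHi.const_mul (2 * r ^ 2 * M)) hle
  rw [integral_const_mul, hcomp] at h1
  have h2 := integral_truncation_sq_div_le hn hΩ hb hu hud hui hu0 hk x₀ hr
  refine h1.trans ?_
  have h3 : (2 * r ^ 2 * M) * ((r ^ n)⁻¹ * ∫ x, H x) ≤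
      (2 * r ^ 2 * M) * ((r ^ n)⁻¹ * (4 * ∫ x in Ω, ‖fderiv ℝ u x‖ ^ 2)) := by
    gcongr
  refine h3.trans (le_of_eq ?_)
  ring

end Truncation

theorem lap_neg {n : ℕ} (u : EuclideanSpace ℝ (Fin n) → ℝ) (x : EuclideanSpace ℝ (Fin n)) :
    lap n (fun y => -u y) x = -lap n u x := by
  have h1 : ∀ y, fderiv ℝ (fun y => -u y) y = -fderiv ℝ u y := fun y => fderiv_fun_neg
  simp [lap, h1]

/-- A quantity `A = X^(2-s) U^a ≥ 1` for which `U²X^N` is at most of order `A^(N/2)` is bounded. -/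
theorem le_rpow_of_sq_mul_rpow_le {U X A N a s D C : ℝ} (hU : 0 < U) (hX : 0 < X) (hA1 : 1 ≤ A)
    (hs0 : 0 < s) (hs2 : s < 2) (hD1 : 1 ≤ D) (hXD : X ≤ D) (hN1 : 1 ≤ N) (hC1 : 1 ≤ C)
    (ha1 : 2 - s ≤ N * a) (ha2 : N * a ≤ 2 * (2 - s)) (hA : A = X ^ (2 - s) * U ^ a)
    (h : U ^ 2 * X ^ N ≤ C * A ^ (N / 2)) : A ≤ (C ^ (2 - s) * D ^ (2 - s)) ^ (2 / s) := by
  have ha0 : 0 < a := by nlinarith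
  have hA0 : 0 < A := by linarith
  have h3 : U ^ a * X ^ (N * a / 2) ≤ C ^ (a / 2) * A ^ (N * a / 4) := by
    have h4 := Real.rpow_le_rpow (by positivity) h (by positivity : 0 ≤ a / 2)
    rw [Real.mul_rpow (by positivity) (by positivity), Real.mul_rpow (by positivity)
      (by positivity), ← Real.rpow_mul hX.le, ← Real.rpow_mul hA0.le, ← Real.rpow_two,
      ← Real.rpow_mul hU.le] at h4
    convert h4 using 3 <;> ring
  have haN : a ≤ N * a := by nlinarith
  have h4 : A ≤ C ^ (2 - s) * D ^ (2 - s) * A ^ (1 - s / 2) := by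
    calc A = (U ^ a * X ^ (N * a / 2)) * X ^ (2 - s - N * a / 2) := by
          rw [mul_assoc, ← Real.rpow_add hX, hA, mul_comm]
          congr 2
          ring
      _ ≤ (C ^ (a / 2) * A ^ (N * a / 4)) * D ^ (2 - s) := by
          gcongr ?_ * ?_
          calc X ^ (2 - s - N * a / 2) ≤ D ^ (2 - s - N * a / 2) :=
                Real.rpow_le_rpow hX.le hXD (by linarith)
            _ ≤ D ^ (2 - s) := Real.rpow_le_rpow_of_exponent_le hD1 (by nlinarith)
      _ ≤ (C ^ (2 - s) * A ^ (1 - s / 2)) * D ^ (2 - s) := by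
          gcongr <;> linarith
      _ = _ := by ring
  have h5 : A ^ (s / 2) ≤ C ^ (2 - s) * D ^ (2 - s) := by
    have h6 : A ^ (s / 2) * A ^ (1 - s / 2) = A := by
      rw [← Real.rpow_add hA0]
      simp
    have h7 : 0 < A ^ (1 - s / 2) := by positivity
    exact le_of_mul_le_mul_right (h6.le.trans h4) h7
  calc A = (A ^ (s / 2)) ^ (2 / s) := by
        rw [← Real.rpow_mul hA0.le]
        have : s / 2 * (2 / s) = 1 := by field_simp
        rw [this, Real.rpow_one]
    _ ≤ (C ^ (2 - s) * D ^ (2 - s)) ^ (2 / s) :=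
        Real.rpow_le_rpow (by positivity) h5 (by positivity)

/-- The maximal value of `‖x‖^(2-s) |u|^a`, attained where `u` is positive, is controlled by the
energy and the growth of the potential. -/
theorem exists_forall_weighted_max_le {n : ℕ} (hn : 3 ≤ n) {Ω : Set (EuclideanSpace ℝ (Fin n))}
    (hΩ : IsOpen Ω) (hb : Bornology.IsBounded Ω) {s : ℝ} (hs0 : 0 < s) (hs2 : s < 2)
    {L D Λ : ℝ} (hL : 0 < L) (hD1 : 1 ≤ D) (hD : ∀ x ∈ Ω, ‖x‖ ≤ D) :
    ∃ C : ℝ, ∀ (u : EuclideanSpace ℝ (Fin n) → ℝ) (a A : ℝ) (x₀ : EuclideanSpace ℝ (Fin n)),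
      ContinuousOn u (closure Ω) → ContDiffOn ℝ 2 u (closure Ω \ {0}) →
      IntegrableOn (fun x => ‖fderiv ℝ u x‖ ^ 2) Ω → (∀ x ∈ frontier Ω, u x = 0) →
      ∫ x in Ω, ‖fderiv ℝ u x‖ ^ 2 ≤ Λ →
      2 - s ≤ ((n : ℝ) - 2) * a → ((n : ℝ) - 2) * a ≤ 2 * (2 - s) →
      x₀ ∈ Ω → x₀ ≠ 0 → 0 < u x₀ → 1 ≤ A → A = ‖x₀‖ ^ (2 - s) * u x₀ ^ a →
      (∀ x ∈ Ω, ‖x‖ ^ (2 - s) * |u x| ^ a ≤ A) →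
      (∀ x ∈ Ω, x ≠ 0 → |lap n u x| ≤ L * A * |u x| / ‖x‖ ^ 2) → A ≤ C := by
  have hn' : (3 : ℝ) ≤ n := by exact_mod_cast hn
  set N : ℝ := (n : ℝ) - 2 with hN
  have hN1 : 1 ≤ N := by linarith
  set K : ℝ := 2 ^ N with hK
  have hK0 : 0 < K := by positivity
  set I : ℝ := ∫ y : EuclideanSpace ℝ (Fin n), averagingKernel y with hI
  set J : ℝ := ∫ y : EuclideanSpace ℝ (Fin n), averagingPrimitive y with hJ
  have hI0 : 0 < I := integral_averagingKernel_pos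
  have hJ0 : 0 ≤ J := integral_nonneg averagingPrimitive_nonneg
  obtain ⟨κ, hκ0, hκ4, hκI⟩ : ∃ κ : ℝ, 0 < κ ∧ κ ≤ 1 / 4 ∧ 6 * K ^ 3 * L * J * κ ^ 2 ≤ I / 16 := by
    have hden : 0 < 96 * K ^ 3 * L * (J + 1) := by positivity
    have hsq : 0 < √(I / (96 * K ^ 3 * L * (J + 1))) := by positivity
    refine ⟨min (1 / 4) (√(I / (96 * K ^ 3 * L * (J + 1)))), by positivity, min_le_left _ _, ?_⟩
    have h1 : min (1 / 4) (√(I / (96 * K ^ 3 * L * (J + 1)))) ^ 2 ≤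
        I / (96 * K ^ 3 * L * (J + 1)) := by
      calc _ ≤ √(I / (96 * K ^ 3 * L * (J + 1))) ^ 2 := by gcongr; exact min_le_right _ _
        _ = _ := Real.sq_sqrt (by positivity)
    calc _ ≤ 6 * K ^ 3 * L * (J + 1) * (I / (96 * K ^ 3 * L * (J + 1))) := by
          gcongr; linarith
      _ = I / 16 := by field_simp; norm_num
  set C₁ : ℝ := max 1 (128 * K * Λ / I / κ ^ N) with hC₁
  have hC₁1 : 1 ≤ C₁ := le_max_left _ _
  refine ⟨(C₁ ^ (2 - s) * D ^ (2 - s)) ^ (2 / s), ?_⟩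
  intro u a A x₀ hu hud hui hu0 hΛ ha1 ha2 hx₀ hx₀0 hux₀ hA1 hA hmax hlap
  have ha0 : 0 < a := by nlinarith
  have hX : 0 < ‖x₀‖ := norm_pos_iff.2 hx₀0
  have hA0 : 0 < A := by linarith
  set X := ‖x₀‖ with hXdef
  set U := u x₀ with hU
  set r : ℝ := κ * X / √A with hr
  have hsA : 1 ≤ √A := Real.one_le_sqrt.2 hA1
  have hr0 : 0 < r := by positivity
  have hrX : r ≤ X / 4 := by
    rw [hr, div_le_iff₀ (by linarith)]
    nlinarith
  have hr2 : r ^ 2 = κ ^ 2 * X ^ 2 / A := by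
    rw [hr, div_pow, Real.sq_sqrt hA0.le, mul_pow]
  have hhalf : ∀ x, ‖x - x₀‖ < r → X / 2 ≤ ‖x‖ := by
    intro x hx
    have := norm_sub_norm_le x₀ x
    rw [norm_sub_rev] at this
    linarith
  have hKu : ∀ x ∈ Ω, ‖x - x₀‖ < r → |u x| ≤ K * U := by
    intro x hx hxr
    have hx2 := hhalf x hxr
    have hx0 : 0 < ‖x‖ := by linarith
    have h1 : ‖x‖ ^ (2 - s) * |u x| ^ a ≤ ‖x‖ ^ (2 - s) * (2 ^ (2 - s) * U ^ a) := by
      calc _ ≤ X ^ (2 - s) * U ^ a := hA ▸ hmax x hx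
        _ ≤ (2 * ‖x‖) ^ (2 - s) * U ^ a := by
          gcongr
          · linarith
        _ = _ := by rw [Real.mul_rpow (by norm_num) hx0.le]; ring
    have h2 : |u x| ^ a ≤ 2 ^ (2 - s) * U ^ a := le_of_mul_le_mul_left h1 (by positivity)
    have h3 : |u x| ^ a ≤ (K * U) ^ a := by
      rw [Real.mul_rpow hK0.le hux₀.le, hK, ← Real.rpow_mul (by norm_num)]
      refine h2.trans ?_
      gcongr
      norm_num
    exact (Real.rpow_le_rpow_iff (abs_nonneg _) (by positivity) ha0).1 h3
  have key := pow_three_le_of_lap_lower_bound hn hΩ hb hu hud hui hu0 (k := U / 2) (by positivity)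
    hx₀ (r := r) (G := 3 * (K * U) ^ 2 * (L * A * (K * U) / (X / 2) ^ 2)) (M := K * U) hr0
    (by linarith) (by positivity) (by positivity)
    (fun x hx hxr => (le_abs_self _).trans (hKu x hx hxr))
    (by
      intro x hx hxr
      have hx2 := hhalf x hxr
      have hx0 : 0 < ‖x‖ := by linarith
      have h1 : |lap n u x| ≤ L * A * (K * U) / (X / 2) ^ 2 := by
        refine (hlap x hx (norm_pos_iff.1 hx0)).trans ?_
        gcongr
        exact hKu x hx hxr
      have h2 : max (u x - U / 2) 0 ≤ K * U :=
        max_le (by linarith [(le_abs_self _).trans (hKu x hx hxr)]) (by positivity)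
      have h3 : 3 * max (u x - U / 2) 0 ^ 2 * |lap n u x| ≤
          3 * (K * U) ^ 2 * (L * A * (K * U) / (X / 2) ^ 2) := by
        gcongr
      have h4 : 3 * max (u x - U / 2) 0 ^ 2 * -|lap n u x| ≤
          3 * max (u x - U / 2) 0 ^ 2 * lap n u x :=
        mul_le_mul_of_nonneg_left (neg_abs_le _) (by positivity)
      linarith)
  have hmaxU : max (u x₀ - U / 2) 0 = U / 2 := by
    rw [← hU, sub_half]
    exact max_eq_left (by positivity)
  rw [hmaxU, ← hI, ← hJ] at key
  have hGterm : 3 * (K * U) ^ 2 * (L * A * (K * U) / (X / 2) ^ 2) * r ^ 2 / 2 * J ≤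
      U ^ 3 * (I / 16) := by
    calc _ = U ^ 3 * (6 * K ^ 3 * L * J * κ ^ 2) := by
          rw [hr2]
          field_simp
          ring
      _ ≤ _ := by gcongr
  have hrn : r ^ 2 / r ^ n = (r ^ N)⁻¹ := by
    rw [hN, Real.rpow_sub hr0, Real.rpow_natCast, Real.rpow_two, inv_div]
  have hΛ' : 8 * (K * U) * (∫ x in Ω, ‖fderiv ℝ u x‖ ^ 2) * (r ^ 2 / r ^ n) ≤
      8 * (K * U) * Λ * (r ^ N)⁻¹ := by
    rw [hrn]
    gcongr
  have hrN : 0 < r ^ N := by positivity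
  have h1 : U ^ 2 * r ^ N ≤ 128 * K * Λ / I := by
    have h2 : U ^ 3 * (I / 16) ≤ 8 * (K * U) * Λ * (r ^ N)⁻¹ := by nlinarith
    rw [← div_eq_mul_inv, le_div_iff₀ hrN] at h2
    rw [le_div_iff₀ hI0]
    have h3 : U * (U ^ 2 * r ^ N * I) ≤ U * (128 * K * Λ) := by linarith
    exact le_of_mul_le_mul_left h3 hux₀
  have h2 : U ^ 2 * X ^ N ≤ C₁ * A ^ (N / 2) := by
    have h3 : r ^ N = κ ^ N * X ^ N / A ^ (N / 2) := by
      rw [hr, Real.div_rpow (by positivity) (by positivity), Real.mul_rpow hκ0.le hX.le,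
        Real.sqrt_eq_rpow, ← Real.rpow_mul hA0.le]
      ring_nf
    rw [h3] at h1
    have hκN : 0 < κ ^ N := by positivity
    have hAN : 0 < A ^ (N / 2) := by positivity
    calc U ^ 2 * X ^ N = U ^ 2 * (κ ^ N * X ^ N / A ^ (N / 2)) / κ ^ N * A ^ (N / 2) := by
          field_simp
      _ ≤ 128 * K * Λ / I / κ ^ N * A ^ (N / 2) := by gcongr
      _ ≤ C₁ * A ^ (N / 2) := by gcongr; exact le_max_right _ _
  exact le_rpow_of_sq_mul_rpow_le hux₀ hX hA1 hs0 hs2 hD1 (hD x₀ hx₀) hN1 hC₁1 ha1 ha2 hA h2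

theorem exists_norm_sq_mul_abs_le {n : ℕ} {Ω : Set (EuclideanSpace ℝ (Fin n))}
    {h : EuclideanSpace ℝ (Fin n) → ℝ} {θ c D : ℝ} (hb : Bornology.IsBounded Ω)
    (hD1 : 1 ≤ D) (hD : ∀ x ∈ Ω, ‖x‖ ≤ D) (hθ : θ < 2)
    (hh : ContinuousOn h (closure Ω \ {0}))
    (hhc : Tendsto (fun x : EuclideanSpace ℝ (Fin n) => ‖x‖ ^ θ * h x)
      (nhdsWithin 0 {(0 : EuclideanSpace ℝ (Fin n))}ᶜ) (nhds c)) :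
    ∃ H : ℝ, 0 ≤ H ∧ ∀ x ∈ Ω, x ≠ 0 → ‖x‖ ^ 2 * |h x| ≤ H := by
  have h1 : ∀ᶠ x in nhdsWithin 0 {(0 : EuclideanSpace ℝ (Fin n))}ᶜ, |‖x‖ ^ θ * h x| < |c| + 1 :=
    hhc.abs.eventually_lt_const (by linarith)
  obtain ⟨δ, hδ0, hδ⟩ := Metric.eventually_nhds_iff.1 (eventually_nhdsWithin_iff.1 h1)
  have hK : IsCompact (closure Ω \ Metric.ball 0 δ) :=
    hb.isCompact_closure.diff Metric.isOpen_ball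
  obtain ⟨M, hM⟩ := hK.exists_bound_of_continuousOn
    (hh.mono (sdiff_subset_sdiff_right (singleton_subset_iff.2 (Metric.mem_ball_self hδ0))))
  refine ⟨D ^ (2 - θ) * (|c| + 1) + D ^ 2 * |M|, by positivity, fun x hx hx0 => ?_⟩
  have hxpos : 0 < ‖x‖ := norm_pos_iff.2 hx0
  by_cases hxδ : ‖x‖ < δ
  · have h2 := hδ (by rwa [dist_zero_right]) hx0
    rw [abs_mul, abs_of_nonneg (by positivity)] at h2
    have h3 : ‖x‖ ^ 2 * |h x| = ‖x‖ ^ (2 - θ) * (‖x‖ ^ θ * |h x|) := by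
      rw [← mul_assoc, ← Real.rpow_add hxpos, sub_add_cancel, Real.rpow_two]
    rw [h3]
    have h4 : ‖x‖ ^ (2 - θ) * (‖x‖ ^ θ * |h x|) ≤ D ^ (2 - θ) * (|c| + 1) :=
      mul_le_mul (Real.rpow_le_rpow hxpos.le (hD x hx) (by linarith)) h2.le (by positivity)
        (by positivity)
    have h5 : 0 ≤ D ^ 2 * |M| := by positivity
    linarith
  · have h2 := hM x ⟨subset_closure hx, by rwa [mem_ball_zero_iff]⟩
    have h3 : ‖x‖ ^ 2 * |h x| ≤ D ^ 2 * |M| :=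
      mul_le_mul (pow_le_pow_left₀ (norm_nonneg x) (hD x hx) 2) (h2.trans (le_abs_self M))
        (abs_nonneg _) (by positivity)
    have h5 : 0 ≤ D ^ (2 - θ) * (|c| + 1) := by positivity
    linarith

/-- Uniform weighted sup bound for families of solutions. -/
theorem stmt_14 (n : ℕ) (hn : 3 ≤ n)
    (Ω : Set (EuclideanSpace ℝ (Fin n))) (hΩ : SmoothDomain Ω)
    (h0 : (0 : EuclideanSpace ℝ (Fin n)) ∈ Ω)
    (s : ℝ) (hs0 : 0 < s) (hs2 : s < 2)
    (γ : ℝ) (hγ : γ < ((n : ℝ) - 2) ^ 2 / 4)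
    (θ c : ℝ) (hθ0 : 0 ≤ θ) (hθ2 : θ < 2)
    (h : EuclideanSpace ℝ (Fin n) → ℝ)
    (hh : ContDiffOn ℝ 1 h (closure Ω \ {0}))
    (hhc : Tendsto (fun x : EuclideanSpace ℝ (Fin n) => ‖x‖ ^ θ * h x)
      (nhdsWithin 0 {(0 : EuclideanSpace ℝ (Fin n))}ᶜ) (nhds c))
    (hhd : Tendsto (fun x : EuclideanSpace ℝ (Fin n) => ‖x‖ ^ θ * fderiv ℝ h x x)
      (nhdsWithin 0 {(0 : EuclideanSpace ℝ (Fin n))}ᶜ) (nhds (-c * θ)))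
    (hcoer : CoerciveOn Ω γ h)
    (b : EuclideanSpace ℝ (Fin n) → ℝ)
    (hb : ContDiffOn ℝ 1 b (closure Ω)) (hbnn : ∀ x ∈ closure Ω, 0 ≤ b x)
    (hb0 : 0 < b 0) (hbd : fderiv ℝ b 0 = 0)
    (p : ℝ → ℝ)
    (hp : ∀ ε : ℝ, 0 < ε → 0 ≤ p ε ∧ p ε < 2 * ((n : ℝ) - s) / ((n : ℝ) - 2) - 2)
    (hp0 : Tendsto p (nhdsWithin 0 (Set.Ioi 0)) (nhds 0))
    (u : ℝ → EuclideanSpace ℝ (Fin n) → ℝ)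
    (hsol : ∀ ε : ℝ, 0 < ε →
      ClassicalSolution Ω γ h b (2 * ((n : ℝ) - s) / ((n : ℝ) - 2) - p ε) s (u ε))
    (Λ : ℝ) (hΛ : ∀ ε : ℝ, 0 < ε → ∫ x in Ω, ‖fderiv ℝ (u ε) x‖ ^ 2 ≤ Λ) :
    ∃ C > (0 : ℝ), ∃ ε₀ > (0 : ℝ), ∀ ε : ℝ, 0 < ε → ε < ε₀ → ∀ x ∈ Ω \ {0},
      ‖x‖ ^ (((n : ℝ) - 2) / 2) *
        |u ε x| ^ (1 - p ε / (2 * ((n : ℝ) - s) / ((n : ℝ) - 2) - 2)) ≤ C := by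
  have hn' : (3 : ℝ) ≤ n := by exact_mod_cast hn
  have hN0 : 0 < (n : ℝ) - 2 := by linarith
  obtain ⟨hΩo, hΩb, -⟩ := hΩ
  set τ : ℝ := 2 * ((n : ℝ) - s) / ((n : ℝ) - 2) - 2 with hτ
  have hτN : ((n : ℝ) - 2) * τ = 2 * (2 - s) := by
    rw [hτ]
    field_simp
    ring
  have hτ0 : 0 < τ := by nlinarith
  obtain ⟨D, hD1, hD⟩ : ∃ D : ℝ, 1 ≤ D ∧ ∀ x ∈ Ω, ‖x‖ ≤ D := by
    obtain ⟨R, hR⟩ := hΩb.exists_norm_le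
    exact ⟨max 1 R, le_max_left _ _, fun x hx => (hR x hx).trans (le_max_right _ _)⟩
  obtain ⟨H, hH0, hH⟩ := exists_norm_sq_mul_abs_le hΩb hD1 hD hθ2 hh.continuousOn hhc
  obtain ⟨B, hB⟩ := hΩb.isCompact_closure.exists_bound_of_continuousOn hb.continuousOn
  have hB0 : 0 ≤ B := (norm_nonneg _).trans (hB 0 (subset_closure h0))
  set L : ℝ := |γ| + H + B + 1 with hL
  have hL0 : 0 < L := by positivity
  obtain ⟨C, hC⟩ := exists_forall_weighted_max_le (Λ := Λ) hn hΩo hΩb hs0 hs2 hL0 hD1 hD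
  obtain ⟨ε₀, hε₀, hpε⟩ : ∃ ε₀ > 0, ∀ ε : ℝ, 0 < ε → ε < ε₀ → p ε < τ / 2 := by
    have h1 := hp0.eventually_lt_const (by positivity : 0 < τ / 2)
    obtain ⟨ε₀, hε₀, h2⟩ := mem_nhdsGT_iff_exists_Ioo_subset.1 h1
    exact ⟨ε₀, hε₀, fun ε h3 h4 => h2 ⟨h3, h4⟩⟩
  refine ⟨max 1 C ^ (1 / τ), by positivity, ε₀, hε₀, fun ε hε hεε₀ x hx => ?_⟩
  obtain ⟨hu, hud, hui, hu0, heq⟩ := hsol ε hε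
  set a : ℝ := τ - p ε with ha
  have hqa : 2 * ((n : ℝ) - s) / ((n : ℝ) - 2) - p ε - 2 = a := by rw [ha, hτ]; ring
  rw [hqa] at heq
  have hp1 := (hp ε hε).1
  have hp2 := hpε ε hε hεε₀
  have ha0 : 0 < a := by linarith
  have ha1 : 2 - s ≤ ((n : ℝ) - 2) * a := by nlinarith
  have ha2 : ((n : ℝ) - 2) * a ≤ 2 * (2 - s) := by nlinarith
  have hmain : ∀ y ∈ Ω, ‖y‖ ^ (2 - s) * |u ε y| ^ a ≤ max 1 C := by
    have hgc : ContinuousOn (fun y => ‖y‖ ^ (2 - s) * |u ε y| ^ a) (closure Ω) :=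
      (continuousOn_id.norm.rpow_const fun _ _ => Or.inr (by linarith)).mul
        (hu.abs.rpow_const fun _ _ => Or.inr ha0.le)
    obtain ⟨x₀, hx₀c, hx₀m⟩ :=
      hΩb.isCompact_closure.exists_isMaxOn ⟨0, subset_closure h0⟩ hgc
    set A : ℝ := ‖x₀‖ ^ (2 - s) * |u ε x₀| ^ a with hA
    have hmax : ∀ y ∈ Ω, ‖y‖ ^ (2 - s) * |u ε y| ^ a ≤ A := fun y hy =>
      hx₀m (subset_closure hy)
    refine fun y hy => (hmax y hy).trans ?_
    rcases le_total A 1 with hA1 | hA1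
    · exact hA1.trans (le_max_left _ _)
    refine le_trans ?_ (le_max_right _ _)
    have hx₀0 : x₀ ≠ 0 := by
      rintro h1
      rw [hA, h1, norm_zero, Real.zero_rpow (by linarith), zero_mul] at hA1
      linarith
    have hux₀ : u ε x₀ ≠ 0 := by
      intro h1
      rw [hA, h1, abs_zero, Real.zero_rpow ha0.ne', mul_zero] at hA1
      linarith
    have hx₀ : x₀ ∈ Ω := by
      by_contra h1
      exact hux₀ (hu0 x₀ ⟨hx₀c, by rwa [hΩo.interior_eq]⟩)
    have hlap : ∀ z ∈ Ω, z ≠ 0 → |lap n (u ε) z| ≤ L * A * |u ε z| / ‖z‖ ^ 2 := by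
      intro z hz hz0
      have hzp : 0 < ‖z‖ := norm_pos_iff.2 hz0
      have h1 : lap n (u ε) z =
          -((γ + ‖z‖ ^ 2 * h z + b z * (‖z‖ ^ (2 - s) * |u ε z| ^ a)) * u ε z / ‖z‖ ^ 2) := by
        have h2 := heq z ⟨hz, hz0⟩
        have h3 : ‖z‖ ^ (2 - s) = ‖z‖ ^ 2 / ‖z‖ ^ s := by
          rw [Real.rpow_sub hzp, Real.rpow_two]
        have h4 : 0 < ‖z‖ ^ s := by positivity
        rw [h3]
        have h5 : (γ + ‖z‖ ^ 2 * h z + b z * (‖z‖ ^ 2 / ‖z‖ ^ s * |u ε z| ^ a)) * u ε z / ‖z‖ ^ 2 =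
            γ * u ε z / ‖z‖ ^ 2 + h z * u ε z + b z * |u ε z| ^ a * u ε z / ‖z‖ ^ s := by
          field_simp
        rw [h5]
        linarith
      have h2 : |γ + ‖z‖ ^ 2 * h z + b z * (‖z‖ ^ (2 - s) * |u ε z| ^ a)| ≤ L * A := by
        have h3 : |‖z‖ ^ 2 * h z| ≤ H := by
          rw [abs_mul, abs_of_nonneg (by positivity)]
          exact hH z hz hz0
        have h4 : |b z * (‖z‖ ^ (2 - s) * |u ε z| ^ a)| ≤ B * A := by
          rw [abs_mul, abs_of_nonneg (by positivity : 0 ≤ ‖z‖ ^ (2 - s) * |u ε z| ^ a)]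
          exact mul_le_mul (hB z (subset_closure hz)) (hmax z hz) (by positivity) hB0
        have h5 := abs_add_three γ (‖z‖ ^ 2 * h z) (b z * (‖z‖ ^ (2 - s) * |u ε z| ^ a))
        nlinarith [abs_nonneg γ]
      rw [h1, abs_neg, abs_div, abs_mul, abs_of_nonneg (by positivity : 0 ≤ ‖z‖ ^ 2)]
      gcongr
    rcases lt_or_gt_of_ne hux₀ with hneg | hpos
    · have hfd : ∀ z, ‖fderiv ℝ (fun y => -u ε y) z‖ = ‖fderiv ℝ (u ε) z‖ := fun z => by
        rw [fderiv_fun_neg, norm_neg]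
      refine hC (fun y => -u ε y) a A x₀ hu.neg hud.neg ?_ ?_ ?_ ha1 ha2 hx₀ hx₀0 (by linarith)
        hA1 ?_ ?_ ?_
      · simpa only [hfd] using hui
      · intro z hz
        rw [hu0 z hz, neg_zero]
      · simpa only [hfd] using hΛ ε hε
      · rw [hA, abs_of_neg hneg]
      · simpa only [abs_neg] using hmax
      · simpa only [lap_neg, abs_neg] using hlap
    · exact hC (u ε) a A x₀ hu hud hui hu0 (hΛ ε hε) ha1 ha2 hx₀ hx₀0 hpos hA1
        (by rw [hA, abs_of_pos hpos]) hmax hlap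
  have h1 : ‖x‖ ^ (((n : ℝ) - 2) / 2) * |u ε x| ^ (1 - p ε / τ) =
      (‖x‖ ^ (2 - s) * |u ε x| ^ a) ^ (1 / τ) := by
    rw [Real.mul_rpow (by positivity) (by positivity), ← Real.rpow_mul (norm_nonneg _),
      ← Real.rpow_mul (abs_nonneg _)]
    congr 2
    · field_simp
      linarith
    · rw [ha]
      field_simp
  rw [h1]
  exact Real.rpow_le_rpow (by positivity) (hmain x hx.1) (by positivity)
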